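/- arXiv:1811.09252 — 6 statements merged into one kernel-verified Lean document; each statement's English description precedes it below -/
import Mathlib

section
/- For every real t ≥ 0 and every k ∈ ℂ with Im k ≥ 0 and k ≠ 0, the kernel G(t,k) = (sin(kt)/k)·e^{ikt} satisfies |G(t,k)| ≤ 1/|k| and |G(t,k)| ≤ t; i.e. |sin(kt)·e^{ikt}/k| ≤ min(t, 1/|k|). -/
open MeasureTheory Complex Filter Set

/-- The kernel `G(t,k) = (sin(kt)/k)·e^{ikt}` for `k ≠ 0`, with `G(t,0) = t`. -/
noncomputable def G (t : ℝ) (k : ℂ) : ℂ :=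
  if k = 0 then (t : ℂ) else Complex.sin (k * t) / k * Complex.exp (Complex.I * k * t)

/-- `exp` is 1-Lipschitz on the closed left half-plane. -/
lemma exp_sub_one_bound (w : ℂ) (hw : w.re ≤ 0) : ‖Complex.exp w - 1‖ ≤ ‖w‖ := by
  have h := Convex.norm_image_sub_le_of_norm_deriv_le (𝕜 := ℂ) (f := Complex.exp) (C := 1)
    (s := {z : ℂ | z.re ≤ 0}) (x := 0) (y := w)
    (fun x _ => Complex.differentiableAt_exp)
    (fun x hx => by
      rw [Complex.deriv_exp, Complex.norm_exp]
      exact Real.exp_le_one_iff.2 hx)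
    (convex_halfSpace_re_le 0) (by simp) hw
  simpa using h

/-- For `t ≥ 0` and `k` in the closed upper half-plane, `k ≠ 0`, the kernel
`G(t,k) = sin(kt)·e^{ikt}/k` satisfies `|G(t,k)| ≤ min(t, 1/|k|)`. -/
theorem kernel_bound (t : ℝ) (ht : 0 ≤ t) (k : ℂ) (hk : 0 ≤ k.im) (hk0 : k ≠ 0) :
    ‖G t k‖ ≤ min t (1 / ‖k‖) := by
  have hkn : 0 < ‖k‖ := norm_pos_iff.2 hk0
  have hre : (2 * (Complex.I * k * t)).re ≤ 0 := by
    have : (2 * (Complex.I * k * t)).re = -(2 * (k.im * t)) := by simp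
    rw [this]
    have := mul_nonneg hk ht
    linarith
  have key : G t k = (1 - Complex.exp (2 * (Complex.I * k * t))) * (Complex.I / 2) / k := by
    have e1 : Complex.exp (-(k * t) * Complex.I) * Complex.exp (Complex.I * k * t) = 1 := by
      rw [← Complex.exp_add, ← Complex.exp_zero]
      congr 1
      ring
    have e2 : Complex.exp ((k * t) * Complex.I) * Complex.exp (Complex.I * k * t)
        = Complex.exp (2 * (Complex.I * k * t)) := by
      rw [← Complex.exp_add]
      congr 1
      ring
    rw [G, if_neg hk0, Complex.sin, ← e2, ← e1]
    ring
  have hn : ‖G t k‖ = ‖Complex.exp (2 * (Complex.I * k * t)) - 1‖ / 2 / ‖k‖ := by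
    rw [key, norm_div, norm_mul, norm_sub_rev]
    simp [div_eq_mul_inv]
  rw [hn]
  refine le_min ?_ ?_
  · have h := exp_sub_one_bound _ hre
    have h2 : ‖2 * (Complex.I * k * t)‖ = 2 * (‖k‖ * t) := by
      simp [abs_of_nonneg ht]
    rw [h2] at h
    rw [div_le_iff₀ hkn]
    linarith
  · have h := norm_sub_le (Complex.exp (2 * (Complex.I * k * t))) 1
    have h2 : ‖Complex.exp (2 * (Complex.I * k * t))‖ ≤ 1 := by
      rw [Complex.norm_exp]
      exact Real.exp_le_one_iff.2 hre
    rw [norm_one] at h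
    gcongr
    linarith
end

section
/- Let q : (0,∞) → ℂ be measurable with ‖q‖₁ = ∫_0^∞ x|q(x)| dx < ∞. Then for every integer n ≥ 1, every x ≥ 0, and every k ∈ ℂ with Im k ≥ 0 (k = 0 included), the iterated simplex integral y_n(x,k) satisfies |y_n(x,k)| ≤ ‖q‖₁ⁿ/n!. -/
open MeasureTheory Complex Filter Set

/-- The previous node `t_{j-1}` of the simplex `x = t₀ < t₁ < ⋯ < t_n`. -/
noncomputable def prevNode (x : ℝ) {n : ℕ} (t : Fin n → ℝ) (j : Fin n) : ℝ :=
  if (j : ℕ) = 0 then x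
  else t ⟨(j : ℕ) - 1, Nat.lt_of_le_of_lt (Nat.sub_le _ _) j.isLt⟩

/-- The iterated simplex integral
`y_n(x,k) = ∫_{x = t₀ < t₁ < ⋯ < t_n} ∏_{j=1}^n G(t_j − t_{j−1}, k)·q(t_j) dt₁⋯dt_n`. -/
noncomputable def ysimp (q : ℝ → ℂ) (n : ℕ) (x : ℝ) (k : ℂ) : ℂ :=
  ∫ t : Fin n → ℝ in {t | StrictMono t ∧ ∀ i, x < t i},
    ∏ j, G (t j - prevNode x t j) k * q (t j)

/-- The Jost function `ψ(k) = 1 + ∑_{n ≥ 1} y_n(0,k)`. -/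
noncomputable def jost (q : ℝ → ℂ) (k : ℂ) : ℂ :=
  1 + ∑' n : ℕ, ysimp q (n + 1) 0 k


lemma norm_exp_sub_one_le_aux (z : ℂ) (hz : z.re ≤ 0) : ‖Complex.exp z - 1‖ ≤ ‖z‖ := by
  have h := Convex.norm_image_sub_le_of_norm_hasDerivWithin_le (𝕜 := ℂ) (f := Complex.exp)
    (f' := Complex.exp) (s := {c : ℂ | c.re ≤ 0}) (C := 1) (x := 0) (y := z)
    (fun w _ => (Complex.hasDerivAt_exp w).hasDerivWithinAt)
    (fun w hw => by
      rw [Complex.norm_exp]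
      exact Real.exp_le_one_iff.mpr hw)
    (convex_halfSpace_re_le 0) (by simp) hz
  simpa using h

lemma norm_G_le (t : ℝ) (ht : 0 ≤ t) (k : ℂ) (hk : 0 ≤ k.im) : ‖G t k‖ ≤ t := by
  unfold G
  split_ifs with h
  · simp [abs_of_nonneg ht]
  · have e : Complex.sin (k * t) / k * Complex.exp (Complex.I * k * t)
        = (Complex.exp (2 * Complex.I * k * t) - 1) / (2 * Complex.I * k) := by
      have h1 : Complex.exp (2 * Complex.I * k * t)
          = Complex.exp (Complex.I * k * t) * Complex.exp (Complex.I * k * t) := by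
        rw [← Complex.exp_add]; congr 1; ring
      have h2 : Complex.exp (-(k * t) * Complex.I) * Complex.exp (Complex.I * k * t) = 1 := by
        rw [← Complex.exp_add, ← Complex.exp_zero]; congr 1; ring
      have h3 : k * t * Complex.I = Complex.I * k * t := by ring
      have hI : Complex.I ≠ 0 := Complex.I_ne_zero
      rw [Complex.sin, h1, h3, ← h2]
      field_simp
      rw [Complex.I_sq]
      ring
    rw [e, norm_div]
    have hpos : 0 < ‖2 * Complex.I * k‖ := by
      rw [norm_pos_iff]; simp [h, Complex.I_ne_zero]
    rw [div_le_iff₀ hpos]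
    refine (norm_exp_sub_one_le_aux _ ?_).trans_eq ?_
    · have : (2 * Complex.I * k * t).re = -(2 * (k.im * t)) := by
        simp [Complex.mul_re, Complex.mul_im]; ring
      rw [this]
      have := mul_nonneg hk ht
      linarith
    · rw [norm_mul, Complex.norm_real, Real.norm_eq_abs, abs_of_nonneg ht, mul_comm]

lemma measurableSet_strictMono_aux (n : ℕ) : MeasurableSet {t : Fin n → ℝ | StrictMono t} := by
  have : {t : Fin n → ℝ | StrictMono t} = ⋂ i, ⋂ j, ⋂ (_ : i < j), {t | t i < t j} := by
    ext t; simp [StrictMono]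
  rw [this]
  exact MeasurableSet.iInter fun i => MeasurableSet.iInter fun j => MeasurableSet.iInter fun _ =>
    measurableSet_lt (measurable_pi_apply i) (measurable_pi_apply j)

lemma simplex_integral_le (n : ℕ) (g : ℝ → ℝ) (hg : Integrable g) (h0 : ∀ y, 0 ≤ g y) :
    ∫ t : Fin n → ℝ in {t | StrictMono t}, ∏ j, g (t j) ≤ (∫ y, g y) ^ n / n.factorial := by
  set S : Set (Fin n → ℝ) := {t | StrictMono t} with hS
  set F : (Fin n → ℝ) → ℝ := fun t => ∏ j, g (t j) with hF
  have hFi : Integrable F := Integrable.fintype_prod (f := fun _ => g) (fun _ => hg)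
  have hF0 : ∀ t, 0 ≤ F t := fun t => Finset.prod_nonneg fun j _ => h0 _
  have hSm : MeasurableSet S := measurableSet_strictMono_aux n
  let e : Equiv.Perm (Fin n) → ((Fin n → ℝ) ≃ᵐ (Fin n → ℝ)) := fun σ =>
    MeasurableEquiv.arrowCongr' σ.symm (MeasurableEquiv.refl ℝ)
  have hea : ∀ σ t, e σ t = t ∘ σ := fun σ t => rfl
  have hep : ∀ σ, MeasurePreserving (e σ) volume volume := fun σ =>
    volume_preserving_arrowCongr' _ _ (MeasurePreserving.id _)
  have hI : ∀ σ, ∫ t in (e σ) ⁻¹' S, F t = ∫ t in S, F t := by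
    intro σ
    rw [← (hep σ).setIntegral_preimage_emb (e σ).measurableEmbedding F S]
    refine integral_congr_ae (Eventually.of_forall fun t => ?_)
    show F t = F (e σ t)
    rw [hea]
    exact (Equiv.prod_comp σ fun j => g (t j)).symm
  have hsum : ∫ t in ⋃ σ ∈ (Finset.univ : Finset (Equiv.Perm (Fin n))), (e σ) ⁻¹' S, F t
      = ∑ σ, ∫ t in (e σ) ⁻¹' S, F t := by
    refine integral_biUnion_finset _ (fun σ _ => (e σ).measurable hSm) ?_
      (fun σ _ => hFi.integrableOn)
    intro σ _ τ _ hne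
    refine Set.disjoint_left.mpr fun t h1 h2 => hne ?_
    have h1 : StrictMono (t ∘ σ) := h1
    have h2 : StrictMono (t ∘ τ) := h2
    have h3 : t ∘ σ = t ∘ τ := by
      refine (StrictMono.range_inj h1 h2).mp ?_
      rw [σ.surjective.range_comp, τ.surjective.range_comp]
    have hinj : Function.Injective t := by
      have := h1.injective.comp σ.symm.injective
      simpa [Function.comp_assoc] using this
    exact Equiv.ext fun i => hinj (congrFun h3 i)
  simp only [hI, Finset.sum_const, Finset.card_univ, Fintype.card_perm, Fintype.card_fin,
    nsmul_eq_mul] at hsum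
  have hle := setIntegral_le_integral (s := ⋃ σ ∈ (Finset.univ : Finset (Equiv.Perm (Fin n))), (e σ) ⁻¹' S) hFi (Eventually.of_forall hF0)
  rw [hsum] at hle
  have hpow : ∫ t, F t = (∫ y, g y) ^ n := by
    have := integral_fintype_prod_volume_eq_pow (ι := Fin n) g
    simpa using this
  rw [le_div_iff₀ (by positivity), mul_comm, ← hpow]
  exact hle

/-- If `q` is measurable with `‖q‖₁ = ∫_0^∞ x|q(x)| dx < ∞`, then for `n ≥ 1`, `x ≥ 0` and
`k` in the closed upper half-plane (including `k = 0`), `|y_n(x,k)| ≤ ‖q‖₁ⁿ/n!`. -/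
theorem ysimp_bound_L1x (q : ℝ → ℂ) (hmq : Measurable q)
    (hq : IntegrableOn (fun x => x * ‖q x‖) (Set.Ioi 0))
    (n : ℕ) (hn : 1 ≤ n) (x : ℝ) (hx : 0 ≤ x) (k : ℂ) (hk : 0 ≤ k.im) :
    ‖ysimp q n x k‖ ≤ (∫ y in Set.Ioi (0:ℝ), y * ‖q y‖) ^ n / n.factorial := by
  have hgi : Integrable ((Set.Ioi (0:ℝ)).indicator fun y => y * ‖q y‖) :=
    (integrable_indicator_iff measurableSet_Ioi).mpr hq
  have hg0 : ∀ y, 0 ≤ (Set.Ioi (0:ℝ)).indicator (fun y => y * ‖q y‖) y := fun y =>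
    Set.indicator_nonneg (fun y hy => mul_nonneg (le_of_lt hy) (norm_nonneg _)) y
  have hmain := simplex_integral_le n _ hgi hg0
  rw [integral_indicator measurableSet_Ioi] at hmain
  refine le_trans ?_ hmain
  have hFi : Integrable (fun t : Fin n → ℝ =>
      ∏ j, (Set.Ioi (0:ℝ)).indicator (fun y => y * ‖q y‖) (t j)) :=
    Integrable.fintype_prod (f := fun _ => (Set.Ioi (0:ℝ)).indicator fun y => y * ‖q y‖)
      (fun _ => hgi)
  have hm : MeasurableSet {t : Fin n → ℝ | StrictMono t ∧ ∀ i, x < t i} := by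
    refine (measurableSet_strictMono_aux n).inter ?_
    have : {t : Fin n → ℝ | ∀ i, x < t i} = ⋂ i, {t | x < t i} := by ext t; simp
    show MeasurableSet {t : Fin n → ℝ | ∀ i, x < t i}
    rw [this]
    exact MeasurableSet.iInter fun i => measurableSet_lt measurable_const (measurable_pi_apply i)
  refine le_trans (norm_integral_le_of_norm_le
    (g := fun t : Fin n → ℝ => ∏ j, (Set.Ioi (0:ℝ)).indicator (fun y => y * ‖q y‖) (t j))
    hFi.integrableOn ?_) ?_
  · refine (ae_restrict_iff' hm).mpr (Eventually.of_forall fun t ht => ?_)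
    obtain ⟨hmono, hxt⟩ := ht
    rw [norm_prod]
    refine Finset.prod_le_prod (fun _ _ => norm_nonneg _) fun j _ => ?_
    have htj : (0:ℝ) < t j := lt_of_le_of_lt hx (hxt j)
    rw [Set.indicator_of_mem (show t j ∈ Set.Ioi (0:ℝ) from htj), norm_mul]
    have hp : 0 ≤ prevNode x t j ∧ prevNode x t j ≤ t j := by
      unfold prevNode
      split_ifs with h
      · exact ⟨hx, (hxt j).le⟩
      · refine ⟨hx.trans (hxt _).le, hmono.monotone ?_⟩
        rw [Fin.le_def]
        exact Nat.sub_le _ _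
    refine mul_le_mul_of_nonneg_right ?_ (norm_nonneg _)
    exact (norm_G_le _ (by linarith [hp.2]) k hk).trans (by linarith [hp.1])
  · refine setIntegral_mono_set hFi.integrableOn
      (Eventually.of_forall fun t => Finset.prod_nonneg fun j _ => hg0 _) ?_
    exact LE.le.eventuallyLE fun t ht => ht.1
end

section
/- Let r₀ > 0 and let (z_j)_{j∈J} be a family of points in ℂ₊ = {Im z > 0} with |z_j| ≤ r₀ for all j and with (Im z_j)_{j∈J} summable; set B_n = 2·∑_{j∈J} Im(z_j^{n+1}) for each integer n ≥ 0. Then for every z ∈ ℂ with |z| > r₀: the family ((z − z_j)/(z − conj(z_j)))_{j∈J} is multipliable, the series ∑_{n≥1} B_{n−1}/(n·zⁿ) converges absolutely, and ∏_{j∈J} (z − z_j)/(z − conj(z_j)) = exp(−i·∑_{n≥1} B_{n−1}/(n·zⁿ)). -/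
open Complex Filter

lemma abs_im_pow_le (z : ℂ) (r : ℝ) (hz : 0 ≤ z.im) (hr : ‖z‖ ≤ r) (n : ℕ) :
    |(z ^ (n + 1)).im| ≤ (n + 1) * r ^ n * z.im := by
  have hr0 : 0 ≤ r := (norm_nonneg z).trans hr
  induction n with
  | zero => simp [abs_of_nonneg hz]
  | succ n ih =>
    have h1 : (z ^ (n + 1 + 1)).im = (z ^ (n + 1)).re * z.im + (z ^ (n + 1)).im * z.re := by
      rw [pow_succ z (n + 1), Complex.mul_im]
    have h2 : |(z ^ (n + 1)).re| ≤ r ^ (n + 1) :=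
      (Complex.abs_re_le_norm _).trans (by rw [norm_pow]; gcongr)
    have h3 : |z.re| ≤ r := (Complex.abs_re_le_norm _).trans hr
    rw [h1]
    calc _ ≤ |(z ^ (n + 1)).re| * z.im + |(z ^ (n + 1)).im| * |z.re| := by
          refine (abs_add_le _ _).trans ?_
          rw [abs_mul, abs_mul, abs_of_nonneg hz]
      _ ≤ r ^ (n + 1) * z.im + ((n + 1) * r ^ n * z.im) * r := by gcongr
      _ = _ := by push_cast; ring

lemma blaschke_factor (z w : ℂ) (h : ‖z‖ < ‖w‖) :
    Complex.exp (-Complex.I * ∑' n : ℕ, ((2 * (z ^ (n + 1)).im : ℝ) : ℂ) / ((n + 1) * w ^ (n + 1)))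
      = (w - z) / (w - (starRingEnd ℂ) z) := by
  have hwpos : 0 < ‖w‖ := (norm_nonneg z).trans_lt h
  have hw : w ≠ 0 := norm_pos_iff.mp hwpos
  have ha : ‖z / w‖ < 1 := by rw [norm_div, div_lt_one hwpos]; exact h
  have hb : ‖(starRingEnd ℂ) z / w‖ < 1 := by
    rw [norm_div, div_lt_one hwpos, RCLike.norm_conj]; exact h
  have ne : ∀ u : ℂ, ‖u‖ < 1 → 1 - u ≠ 0 := by
    intro u hu h0
    rw [← sub_eq_zero.mp h0] at hu
    simp at hu
  have Ha := Complex.hasSum_taylorSeries_neg_log' ha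
  have Hb := Complex.hasSum_taylorSeries_neg_log' hb
  have H := (Ha.sub Hb).mul_left (-Complex.I)
  have H' : HasSum (fun n : ℕ => ((2 * (z ^ (n + 1)).im : ℝ) : ℂ) / ((n + 1) * w ^ (n + 1)))
      (-Complex.I * (-Complex.log (1 - z / w) + Complex.log (1 - (starRingEnd ℂ) z / w))) := by
    convert! H using 1
    · funext n
      have e := Complex.sub_conj (z ^ (n + 1))
      have hn : (n : ℂ) + 1 ≠ 0 := by exact_mod_cast Nat.succ_ne_zero n
      rw [map_pow] at e
      rw [div_pow, div_pow, div_div, div_div, ← sub_div, mul_comm (w ^ (n + 1)), e]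
      push_cast
      rw [← mul_div_assoc]
      congr 1
      linear_combination (2 * ((z ^ (n + 1)).im : ℂ)) * Complex.I_sq
    · rw [sub_neg_eq_add]
  rw [H'.tsum_eq]
  have e : -Complex.I * (-Complex.I * (-Complex.log (1 - z / w) +
      Complex.log (1 - (starRingEnd ℂ) z / w))) =
      Complex.log (1 - z / w) - Complex.log (1 - (starRingEnd ℂ) z / w) := by
    linear_combination (-Complex.log (1 - z / w) +
      Complex.log (1 - (starRingEnd ℂ) z / w)) * Complex.I_sq
  rw [e, Complex.exp_sub, Complex.exp_log (ne _ ha), Complex.exp_log (ne _ hb),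
    one_sub_div hw, one_sub_div hw, div_div_div_cancel_right₀ hw]

/-- If `(z_j)` is a family in the open upper half-plane with `|z_j| ≤ r₀` and `(Im z_j)`
summable, and `B_n = 2·∑_j Im(z_j^{n+1})`, then for `|z| > r₀` the Blaschke family
`((z − z_j)/(z − conj z_j))` is multipliable, the series `∑_{n≥1} B_{n−1}/(n·zⁿ)` converges
absolutely, and `∏_j (z − z_j)/(z − conj z_j) = exp(−i·∑_{n≥1} B_{n−1}/(n·zⁿ))`. -/
theorem blaschke_log_expansion {J : Type*} (r₀ : ℝ) (hr₀ : 0 < r₀) (z : J → ℂ)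
    (hz : ∀ j, 0 < (z j).im) (hzb : ∀ j, ‖z j‖ ≤ r₀)
    (hsum : Summable fun j => (z j).im)
    (B : ℕ → ℝ) (hB : ∀ n : ℕ, B n = 2 * ∑' j, ((z j) ^ (n + 1)).im)
    (w : ℂ) (hw : r₀ < ‖w‖) :
    Multipliable (fun j => (w - z j) / (w - (starRingEnd ℂ) (z j))) ∧
      Summable (fun n : ℕ => ‖(B n : ℂ) / ((n + 1) * w ^ (n + 1))‖) ∧
      ∏' j, (w - z j) / (w - (starRingEnd ℂ) (z j)) =
        Complex.exp (-Complex.I * ∑' n : ℕ, (B n : ℂ) / ((n + 1) * w ^ (n + 1))) := by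
  have hwpos : 0 < ‖w‖ := hr₀.trans hw
  set F : J → ℕ → ℂ := fun j n =>
    ((2 * ((z j) ^ (n + 1)).im : ℝ) : ℂ) / ((n + 1) * w ^ (n + 1)) with hF
  have hbound : ∀ j n, ‖F j n‖ ≤ (z j).im * (2 / ‖w‖ * (r₀ / ‖w‖) ^ n) := by
    intro j n
    have hn : ‖((n : ℂ) + 1)‖ = (n : ℝ) + 1 := by
      rw [show ((n : ℂ) + 1) = ((n + 1 : ℕ) : ℂ) by push_cast; rfl, Complex.norm_natCast]
      push_cast; rfl
    have h1 := abs_im_pow_le (z j) r₀ (hz j).le (hzb j) n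
    simp only [hF]
    rw [norm_div, norm_mul, norm_pow, hn, Complex.norm_real, Real.norm_eq_abs, abs_mul, abs_two,
      div_le_iff₀ (by positivity)]
    calc _ ≤ 2 * ((n + 1) * r₀ ^ n * (z j).im) := by gcongr
      _ = _ := by rw [div_pow]; field_simp; ring
  have hgeo : Summable fun n : ℕ => 2 / ‖w‖ * (r₀ / ‖w‖) ^ n :=
    (summable_geometric_of_lt_one (by positivity) ((div_lt_one hwpos).mpr hw)).mul_left _
  have hprod : Summable fun p : J × ℕ => (z p.1).im * (2 / ‖w‖ * (r₀ / ‖w‖) ^ p.2) :=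
    hsum.mul_of_nonneg hgeo (fun j => (hz j).le) (fun n => by positivity)
  have hnorm : Summable fun p : J × ℕ => ‖F p.1 p.2‖ :=
    hprod.of_nonneg_of_le (fun p => norm_nonneg _) (fun p => hbound p.1 p.2)
  have hFs : Summable fun p : J × ℕ => F p.1 p.2 := hnorm.of_norm
  have hBF : ∀ n : ℕ, (B n : ℂ) / ((n + 1) * w ^ (n + 1)) = ∑' j, F j n := by
    intro n
    simp only [hF]
    rw [tsum_div_const, hB, ← tsum_mul_left, Complex.ofReal_tsum]
  have hS : Summable (fun n : ℕ => ‖(B n : ℂ) / ((n + 1) * w ^ (n + 1))‖) := by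
    have := (hFs.prod_symm).prod
    simp only [hBF]
    exact this.norm
  have hJ : HasSum (fun j => ∑' n, F j n) (∑' n, ∑' j, F j n) := by
    have h2 : ∑' n, ∑' j, F j n = ∑' j, ∑' n, F j n := Summable.tsum_comm hFs
    rw [h2]
    exact hFs.prod.hasSum
  have hP := (hJ.mul_left (-Complex.I)).cexp
  have hP' : HasProd (fun j => (w - z j) / (w - (starRingEnd ℂ) (z j)))
      (Complex.exp (-Complex.I * ∑' n, ∑' j, F j n)) := by
    convert! hP using 1
    funext j
    exact (blaschke_factor (z j) w ((hzb j).trans_lt hw)).symm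
  refine ⟨hP'.multipliable, hS, ?_⟩
  rw [hP'.tprod_eq]
  simp only [hBF]
end

section
/- Let r₀ > 0 and let (z_j)_{j∈J} be a family of points in ℂ₊ = {Im z > 0} with |z_j| ≤ r₀ for all j and with (Im z_j)_{j∈J} summable. Then for every k ∈ ℂ₊ the family ((k − z_j)/(k − conj(z_j)))_{j∈J} is multipliable and the Blaschke product B(k) = ∏_{j∈J} (k − z_j)/(k − conj(z_j)) satisfies |B(k)| ≤ 1. -/
open Complex Filter

/-- If `(z_j)` is a family in the open upper half-plane with `|z_j| ≤ r₀` and `(Im z_j)`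
summable, then for every `k` in the open upper half-plane the Blaschke family
`((k − z_j)/(k − conj z_j))` is multipliable and `|∏_j (k − z_j)/(k − conj z_j)| ≤ 1`. -/
theorem blaschke_bounded {J : Type*} (r₀ : ℝ) (hr₀ : 0 < r₀) (z : J → ℂ)
    (hz : ∀ j, 0 < (z j).im) (hzb : ∀ j, ‖z j‖ ≤ r₀)
    (hsum : Summable fun j => (z j).im)
    (k : ℂ) (hk : 0 < k.im) :
    Multipliable (fun j => (k - z j) / (k - (starRingEnd ℂ) (z j))) ∧
      ‖∏' j, (k - z j) / (k - (starRingEnd ℂ) (z j))‖ ≤ 1 := by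
  have hden : ∀ j, k.im ≤ ‖k - (starRingEnd ℂ) (z j)‖ := fun j => by
    have h1 := Complex.abs_im_le_norm (k - (starRingEnd ℂ) (z j))
    have h2 := le_abs_self (k - (starRingEnd ℂ) (z j)).im
    have h3 : (k - (starRingEnd ℂ) (z j)).im = k.im + (z j).im := by simp
    have := hz j
    linarith
  have hpos : ∀ j, 0 < ‖k - (starRingEnd ℂ) (z j)‖ := fun j => hk.trans_le (hden j)
  have hle : ∀ j, ‖(k - z j) / (k - (starRingEnd ℂ) (z j))‖ ≤ 1 := fun j => by
    rw [norm_div, div_le_one (hpos j), ← sq_le_sq₀ (norm_nonneg _) (norm_nonneg _),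
      Complex.sq_norm, Complex.sq_norm, Complex.normSq_apply, Complex.normSq_apply]
    simp only [Complex.sub_re, Complex.sub_im, Complex.conj_re, Complex.conj_im]
    nlinarith [mul_pos hk (hz j)]
  have heq : (fun j => (k - z j) / (k - (starRingEnd ℂ) (z j))) =
      fun j => 1 + ((starRingEnd ℂ) (z j) - z j) / (k - (starRingEnd ℂ) (z j)) := by
    funext j
    have h0 : k - (starRingEnd ℂ) (z j) ≠ 0 := norm_pos_iff.mp (hpos j)
    rw [eq_comm, ← div_self h0, ← add_div]
    congr 1
    ring
  have hm : Multipliable (fun j => (k - z j) / (k - (starRingEnd ℂ) (z j))) := by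
    rw [heq]
    apply multipliable_one_add_of_summable
    refine Summable.of_nonneg_of_le (fun j => norm_nonneg _) (fun j => ?_)
      (hsum.mul_left (2 / k.im))
    have hn : ‖(starRingEnd ℂ) (z j) - z j‖ = 2 * (z j).im := by
      rw [norm_sub_rev, Complex.sub_conj, norm_mul, Complex.norm_I, mul_one,
        Complex.norm_real, Real.norm_eq_abs, abs_of_pos (by linarith [hz j])]
    rw [norm_div, hn, div_mul_eq_mul_div]
    exact div_le_div_of_nonneg_left (by linarith [hz j]) hk (hden j)
  refine ⟨hm, le_of_tendsto hm.hasProd.norm (Eventually.of_forall fun s => ?_)⟩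
  exact Finset.prod_le_one (fun j _ => norm_nonneg _) (fun j _ => hle j)
end

section
/- Let m ≥ 0 be an integer, h : ℝ → ℝ locally integrable, and I₀,…,I_m real numbers. Define h₋₁ = h and h_j(t) = t·h_{j−1}(t) + I_j for 0 ≤ j ≤ m (so that h_j(t) = t^{j+1}·(h(t) + I₀/t + I₁/t² + ⋯ + I_j/t^{j+1})). Assume: (a) h_m(t) → 0 as t → +∞ and as t → −∞; (b) for each 0 ≤ j ≤ m the principal value 𝒥_j = (1/π)·lim_{s→∞} ∫_{−s}^{s} h_{j−1}(t) dt exists; (c) for each k with Im k > 0 the principal value M_m(k) = (1/π)·lim_{s→∞} ∫_{−s}^{s} h_m(t)/(k−t) dt exists. Then for every k with Im k > 0 the principal value M(k) = (1/π)·lim_{s→∞} ∫_{−s}^{s} h(t)/(k−t) dt exists and M(k) = ∑_{j=0}^{m} (𝒥_j + i·I_j)/k^{j+1} + M_m(k)/k^{m+1}. -/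
open MeasureTheory Complex Filter Set intervalIntegral


lemma pv_aux (k : ℂ) (hk : 0 < k.im) :
    Tendsto (fun s : ℝ => ∫ t in (-s)..s, (1 : ℂ) / (k - t)) atTop
      (nhds (-(Real.pi * Complex.I))) := by
  have h1 : ∀ s : ℝ, ∫ t in (-s)..s, (1 : ℂ) / (k - t)
      = Complex.log (k + s) - Complex.log (k - s) := by
    intro s
    have hne : ∀ t : ℝ, k - t ≠ 0 := by
      intro t ht
      have := congrArg Complex.im ht
      simp at this
      exact hk.ne' this
    have := integral_eq_sub_of_hasDerivAt (a := -s) (b := s)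
      (f := fun t : ℝ => - Complex.log (k - t)) (f' := fun t : ℝ => (1 : ℂ) / (k - t)) ?_ ?_
    · rw [this]; push_cast; ring_nf
    · intro t _
      have h2 : HasDerivAt (fun t : ℝ => k - (t : ℂ)) (-1) t := by
        simpa using (Complex.ofRealCLM.hasDerivAt (x := t)).const_sub k
      have h3 := (h2.clog_real (by right; simpa using hk.ne')).neg
      have e : (1 : ℂ) / (k - t) = -(-1 / (k - t)) := by rw [neg_div, neg_neg]
      rw [e]
      exact h3
    · apply Continuous.intervalIntegrable
      exact continuous_const.div (by fun_prop) hne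
  have hinv : Tendsto (fun s : ℝ => k / (s : ℂ)) atTop (nhds 0) := by
    have : Tendsto (fun s : ℝ => ((s⁻¹ : ℝ) : ℂ)) atTop (nhds ((0 : ℝ) : ℂ)) :=
      (Complex.continuous_ofReal.tendsto 0).comp tendsto_inv_atTop_zero
    simpa [div_eq_mul_inv] using this.const_mul k
  have hA : Tendsto (fun s : ℝ => Complex.log (1 + k / s)) atTop (nhds 0) := by
    have h2 : Tendsto (fun s : ℝ => 1 + k / (s : ℂ)) atTop (nhds 1) := by
      simpa using hinv.const_add 1
    have := h2.clog (by simp)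
    simpa using this
  have hB : Tendsto (fun s : ℝ => Complex.log (-1 + k / s)) atTop
      (nhds (Real.pi * Complex.I)) := by
    have h2 : Tendsto (fun s : ℝ => -1 + k / (s : ℂ)) atTop (nhds (-1)) := by
      simpa using hinv.const_add (-1)
    have h3 : Tendsto (fun s : ℝ => -1 + k / (s : ℂ)) atTop
        (nhdsWithin (-1) {z : ℂ | 0 ≤ z.im}) := by
      refine tendsto_nhdsWithin_iff.2 ⟨h2, ?_⟩
      filter_upwards [eventually_gt_atTop 0] with s hs
      simp only [add_im, neg_im, one_im, neg_zero, zero_add, Complex.div_ofReal_im]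
      positivity
    have h4 := (Complex.tendsto_log_nhdsWithin_im_nonneg_of_re_neg_of_im_zero
      (z := -1) (by simp) (by simp)).comp h3
    simpa [Function.comp_def] using h4
  have := hA.sub hB
  rw [zero_sub] at this
  refine this.congr' ?_
  filter_upwards [eventually_gt_atTop 0] with s hs
  have hs' : (s : ℂ) ≠ 0 := by exact_mod_cast hs.ne'
  have n1 : 1 + k / (s : ℂ) ≠ 0 := by
    intro h0
    have := congrArg Complex.im h0
    simp [Complex.div_ofReal_im] at this
    rcases this with h | h <;> linarith
  have n2 : -1 + k / (s : ℂ) ≠ 0 := by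
    intro h0
    have := congrArg Complex.im h0
    simp [Complex.div_ofReal_im] at this
    rcases this with h | h <;> linarith
  have e1 : k + s = s * (1 + k / s) := by field_simp; ring
  have e2 : k - s = s * (-1 + k / s) := by field_simp; ring
  rw [h1, e1, e2, Complex.log_ofReal_mul hs n1, Complex.log_ofReal_mul hs n2]
  ring

lemma pv_step (k : ℂ) (hk : 0 < k.im) (g : ℝ → ℝ) (hg : LocallyIntegrable g volume)
    (c J : ℝ) (M : ℂ)
    (hJ : Tendsto (fun s : ℝ => (1 / Real.pi) * ∫ t in (-s)..s, g t) atTop (nhds J))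
    (hM : Tendsto (fun s : ℝ => (1 / (Real.pi : ℂ)) *
      ∫ t in (-s)..s, ((t * g t + c : ℝ) : ℂ) / (k - t)) atTop (nhds M)) :
    Tendsto (fun s : ℝ => (1 / (Real.pi : ℂ)) * ∫ t in (-s)..s, (g t : ℂ) / (k - t)) atTop
      (nhds (((J : ℂ) + Complex.I * c + M) / k)) := by
  have hpi : (Real.pi : ℂ) ≠ 0 := by exact_mod_cast Real.pi_ne_zero
  have hk0 : k ≠ 0 := by rintro rfl; simp at hk
  have hne : ∀ t : ℝ, k - t ≠ 0 := by
    intro t ht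
    have := congrArg Complex.im ht
    simp at this
    exact hk.ne' this
  have hJ' : Tendsto (fun s : ℝ => (1 / (Real.pi : ℂ)) * ∫ t in (-s)..s, (g t : ℂ)) atTop
      (nhds (J : ℂ)) := by
    have := (Complex.continuous_ofReal.tendsto J).comp hJ
    refine this.congr fun s => ?_
    simp [intervalIntegral.integral_ofReal]
  have hP := ((pv_aux k hk).const_mul ((1 / (Real.pi : ℂ)) * c))
  have key := ((hJ'.add hM).sub hP).div_const k
  have e : ((J : ℂ) + M - 1 / (Real.pi : ℂ) * c * -(Real.pi * Complex.I)) / k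
      = ((J : ℂ) + Complex.I * c + M) / k := by
    congr 1
    field_simp
    ring
  rw [e] at key
  refine key.congr fun s => ?_
  have hg0 : IntervalIntegrable g volume (-s) s :=
    ((hg.integrableOn_isCompact isCompact_uIcc)).intervalIntegrable
  have hgi : IntervalIntegrable (fun t => (g t : ℂ)) volume (-s) s :=
    ⟨hg0.1.ofReal,
      hg0.2.ofReal⟩
  have hci : Continuous (fun t : ℝ => (1 : ℂ) / (k - t)) :=
    continuous_const.div (by fun_prop) hne
  have i1 : IntervalIntegrable (fun t : ℝ => ((t * g t + c : ℝ) : ℂ) / (k - t)) volume (-s) s := by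
    have a1 : IntervalIntegrable (fun t : ℝ => (g t : ℂ) * ((t : ℂ) * (1 / (k - t)))) volume (-s) s :=
      hgi.mul_continuousOn (Continuous.continuousOn (by fun_prop))
    have a2 : IntervalIntegrable (fun t : ℝ => (c : ℂ) * (1 / (k - t))) volume (-s) s :=
      (continuous_const.mul hci).intervalIntegrable _ _
    convert a1.add a2 using 1
    funext t
    push_cast
    ring
  have i2 : IntervalIntegrable (fun t : ℝ => (c : ℂ) * (1 / (k - t))) volume (-s) s :=
    (continuous_const.mul hci).intervalIntegrable _ _
  have : ∫ t in (-s)..s, (g t : ℂ) / (k - t) =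
      ((∫ t in (-s)..s, (g t : ℂ)) + (∫ t in (-s)..s, ((t * g t + c : ℝ) : ℂ) / (k - t))
        - c * ∫ t in (-s)..s, (1 : ℂ) / (k - t)) / k := by
    rw [← intervalIntegral.integral_const_mul, ← intervalIntegral.integral_add hgi i1,
      ← intervalIntegral.integral_sub (hgi.add i1) i2, ← intervalIntegral.integral_div]
    congr 1
    funext t
    have := hne t
    push_cast
    field_simp
    ring
  rw [this]
  ring

/-- Asymptotic expansion of the principal-value Cauchy transform. Here `hfam 0 = h = h₋₁`
and `hfam (j+1) = h_j` where `h_j(t) = t·h_{j−1}(t) + I_j` (with `c j = I_j`). Assuming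
`h_m → 0` at `±∞`, the existence of the principal values `𝒥_j` (for `0 ≤ j ≤ m`) and of
`M_m(k)` for `Im k > 0`, the principal value `M(k) = (1/π) p.v.∫ h(t)/(k−t) dt` exists and
`M(k) = ∑_{j=0}^m (𝒥_j + i·I_j)/k^{j+1} + M_m(k)/k^{m+1}`. -/
theorem cauchy_transform_expansion (m : ℕ) (h : ℝ → ℝ)
    (hloc : LocallyIntegrable h volume)
    (c : ℕ → ℝ) (hfam : ℕ → ℝ → ℝ)
    (hfam0 : hfam 0 = h)
    (hfamS : ∀ j : ℕ, hfam (j + 1) = fun t => t * hfam j t + c j)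
    (htop : Tendsto (hfam (m + 1)) atTop (nhds 0))
    (hbot : Tendsto (hfam (m + 1)) atBot (nhds 0))
    (Jc : ℕ → ℝ)
    (hJ : ∀ j ≤ m, Tendsto (fun s : ℝ => (1 / Real.pi) * ∫ t in (-s)..s, hfam j t)
      atTop (nhds (Jc j)))
    (Mm : ℂ → ℂ)
    (hMm : ∀ k : ℂ, 0 < k.im →
      Tendsto (fun s : ℝ => (1 / (Real.pi : ℂ)) * ∫ t in (-s)..s, (hfam (m + 1) t : ℂ) / (k - t))
        atTop (nhds (Mm k))) :
    ∀ k : ℂ, 0 < k.im →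
      Tendsto (fun s : ℝ => (1 / (Real.pi : ℂ)) * ∫ t in (-s)..s, (h t : ℂ) / (k - t)) atTop
        (nhds (∑ j ∈ Finset.range (m + 1),
            ((Jc j : ℂ) + Complex.I * (c j : ℂ)) / k ^ (j + 1) + Mm k / k ^ (m + 1))) := by
  intro k hk
  have hli : ∀ j, LocallyIntegrable (hfam j) volume := by
    intro j
    induction j with
    | zero => rw [hfam0]; exact hloc
    | succ j ih =>
      rw [hfamS]
      have h1 : LocallyIntegrable (fun t => t * hfam j t) volume := by
        rw [← locallyIntegrableOn_univ] at ih ⊢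
        exact ih.continuousOn_mul continuousOn_id isOpen_univ.isLocallyClosed
      exact h1.add (continuous_const.locallyIntegrable)
  have main : ∀ n ≤ m + 1, ∀ M : ℂ,
      Tendsto (fun s : ℝ => (1 / (Real.pi : ℂ)) * ∫ t in (-s)..s, (hfam n t : ℂ) / (k - t))
        atTop (nhds M) →
      Tendsto (fun s : ℝ => (1 / (Real.pi : ℂ)) * ∫ t in (-s)..s, (h t : ℂ) / (k - t)) atTop
        (nhds (∑ j ∈ Finset.range n,
            ((Jc j : ℂ) + Complex.I * (c j : ℂ)) / k ^ (j + 1) + M / k ^ n)) := by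
    intro n
    induction n with
    | zero => intro _ M hM; rw [hfam0] at hM; simpa using hM
    | succ n ih =>
      intro hn M hM
      rw [hfamS] at hM
      have := ih (by omega) _ (pv_step k hk (hfam n) (hli n) (c n) (Jc n) M (hJ n (by omega)) hM)
      convert this using 2
      rw [Finset.sum_range_succ, add_assoc]
      congr 1
      rw [div_div, ← pow_succ', ← add_div]
  exact main (m + 1) le_rfl _ (hMm k hk)
end

section
/- Let g ∈ L¹((0,∞); ℂ) and ĝ(t) = ∫_0^∞ e^{2itx}·g(x) dx for t ∈ ℝ. Then for every k with Im k > 0: lim_{s→∞} ∫_{−s}^{s} ĝ(t)/(k−t) dt = −2πi·∫_0^∞ e^{2ikx}·g(x) dx, and lim_{s→∞} ∫_{−s}^{s} ĝ(−t)/(k−t) dt = 0. -/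
open MeasureTheory Complex Filter Set

/-- Boundary integral over the square `[-s,s] × [0,s]`. -/
noncomputable def sqBd (f : ℂ → ℂ) (s : ℝ) : ℂ :=
  (∫ t in (-s)..s, f (t : ℂ)) - (∫ t in (-s)..s, f (t + s * I))
    + I * (∫ y in (0:ℝ)..s, f (s + y * I)) - I * (∫ y in (0:ℝ)..s, f (-s + y * I))

lemma sqBd_eq_zero (f : ℂ → ℂ) (s : ℝ) (hs : 0 < s) (S : Set ℂ) (hS : S.Countable)
    (hc : ∀ z : ℂ, 0 ≤ z.im → ContinuousAt f z)
    (hd : ∀ z : ℂ, 0 ≤ z.im → z ∉ S → DifferentiableAt ℂ f z) : sqBd f s = 0 := by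
  have h := Complex.integral_boundary_rect_eq_zero_of_differentiable_on_off_countable f
    (-s : ℂ) (s + s * I) S hS ?_ ?_
  · unfold sqBd
    simpa using h
  · intro z hz
    apply (hc z ?_).continuousWithinAt
    have := hz.2
    simp [uIcc_of_le hs.le] at this
    exact this.1
  · intro z hz
    apply hd z ?_ hz.2
    have := hz.1.2
    simp [hs.le] at this
    exact this.1.le

lemma log_rot (u : ℂ) (hu : 0 < u.re) : Complex.log (-I * u) = Complex.log u - I * (Real.pi / 2) := by
  have hu0 : u ≠ 0 := by rintro rfl; simp at hu
  have h1 := Complex.abs_arg_lt_pi_div_two_iff.2 (Or.inl hu)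
  rw [abs_lt] at h1
  have hp := Real.pi_pos
  rw [Complex.log_mul (by simp) hu0]
  · rw [Complex.log_neg_I]; ring
  · rw [Complex.arg_neg_I]; constructor <;> linarith

lemma side_int (a b c k d : ℂ) (p q : ℝ) (hpq : p ≤ q) (ha : a ≠ 0)
    (h : ∀ t ∈ Icc p q, 0 < (a * (b + t * c - k)).re) (hd : d = b) :
    c * ∫ t in p..q, 1 / (k - (d + t * c)) =
      -(Complex.log (a * (b + q * c - k)) - Complex.log (a * (b + p * c - k))) := by
  subst hd
  rw [← intervalIntegral.integral_const_mul, ← neg_inj, ← intervalIntegral.integral_neg, neg_neg]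
  have key : ∀ t ∈ Icc p q, (d + t * c - k) ≠ 0 := by
    intro t ht h0
    have := h t ht
    simp [h0] at this
  apply intervalIntegral.integral_eq_sub_of_hasDerivAt
    (f := fun t : ℝ => Complex.log (a * (d + t * c - k)))
  · intro t ht
    rw [uIcc_of_le hpq] at ht
    have h1 : HasDerivAt (fun t : ℝ => a * (d + t * c - k)) (a * (1 * c)) t := by
      have : HasDerivAt (fun t : ℝ => (t : ℂ)) 1 t := Complex.ofRealCLM.hasDerivAt
      exact (((this.mul_const c).const_add d).sub_const k).const_mul a
    have h2 := h1.clog_real (Or.inl (h t ht))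
    refine h2.congr_deriv ?_
    symm
    have := key t ht
    have h3 : k - (d + t * c) ≠ 0 := by
      intro h0; apply this; linear_combination -h0
    rw [one_mul, mul_div_mul_left _ _ ha, mul_one_div, ← neg_div, div_eq_div_iff h3 this]
    ring
  · apply ContinuousOn.intervalIntegrable
    rw [uIcc_of_le hpq]
    refine ContinuousOn.neg (ContinuousOn.mul continuousOn_const (ContinuousOn.div continuousOn_const (by fun_prop) ?_))
    intro t ht h0
    apply key t ht; linear_combination -h0

lemma sqBd_inv (k : ℂ) (hk : 0 < k.im) (s : ℝ) (hs : ‖k‖ < s) :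
    sqBd (fun z => 1 / (k - z)) s = -(2 * Real.pi * I) := by
  have h1 := abs_le.1 (Complex.abs_re_le_norm k)
  have h2 := abs_le.1 (Complex.abs_im_le_norm k)
  have h0 := norm_nonneg k
  have e1 := side_int I 0 1 k 0 (-s) s (by linarith) (by simp)
    (by intro t ht; simp; exact hk) rfl
  have e2 := side_int (-I) (s * I) 1 k (s*I) (-s) s (by linarith) (by simp)
    (by intro t ht; simp; linarith) rfl
  have e3 := side_int 1 s I k s 0 s (by linarith) (by simp)
    (by intro t ht; simp; linarith) rfl
  have e4 := side_int (-1) (-s) I k (-s) 0 s (by linarith) (by simp)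
    (by intro t ht; simp; linarith) rfl
  have c1 := log_rot (-(-s - k)) (by simp; linarith)
  have c2 := log_rot (I * (s - k)) (by simp; linarith)
  have c3 := log_rot (s + s * I - k) (by simp; linarith)
  have c4 := log_rot (-I * (-s + s * I - k)) (by simp; linarith)
  have r1 : -I * -(-(s:ℂ) - k) = I * (-s - k) := by ring
  have r2 : -I * (I * ((s:ℂ) - k)) = s - k := by linear_combination (-(s - k) : ℂ) * I_sq
  have r4 : -I * (-I * (-(s:ℂ) + s * I - k)) = -(-s + s * I - k) := by
    linear_combination ((-(s:ℂ) + s * I - k) : ℂ) * I_sq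
  rw [r1] at c1
  rw [r2] at c2
  rw [r4] at c4
  have q1 : (s:ℂ) * I + s - k = s + s * I - k := by ring
  have q2 : (s:ℂ) * I + -s - k = -s + s * I - k := by ring
  simp only [ofReal_neg, mul_one, zero_add, one_mul, ofReal_zero, zero_mul, add_zero, neg_one_mul, q1, q2] at e1 e2 e3 e4
  have q3 : ∀ t : ℝ, (t:ℂ) + s * I = s * I + t := fun t => by ring
  unfold sqBd
  simp only [q3]
  rw [e1, e2, e3, e4, c1, c2, c3, c4]
  ring

lemma sq_res (k : ℂ) (hk : 0 < k.im) (s : ℝ) (hs : ‖k‖ < s) (x : ℝ) :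
    sqBd (fun z => exp (2 * I * z * x) / (k - z)) s = -(2 * Real.pi * I) * exp (2 * I * k * x) := by
  have h1 := abs_le.1 (Complex.abs_re_le_norm k)
  have h2 := abs_le.1 (Complex.abs_im_le_norm k)
  have h0 := norm_nonneg k
  set f : ℂ → ℂ := fun z => exp (2 * I * z * x) with hf
  have hfd : Differentiable ℂ f := by rw [hf]; fun_prop
  have hz := sqBd_eq_zero (dslope f k) s (by linarith) {k} (countable_singleton k)
    (by
      intro z _
      by_cases h : z = k
      · subst h; exact continuousAt_dslope_same.2 (hfd _)
      · exact (continuousAt_dslope_of_ne h).2 (hfd _).continuousAt)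
    (by
      intro z _ h
      exact (differentiableAt_dslope_of_ne h).2 (hfd _))
  rw [← sqBd_inv k hk s hs]
  have key : ∀ (γ : ℝ → ℂ), Continuous γ → ∀ p q : ℝ, (∀ t ∈ uIcc p q, γ t ≠ k) →
      ∫ t in p..q, f (γ t) / (k - γ t) =
        (∫ t in p..q, 1 / (k - γ t)) * f k - ∫ t in p..q, dslope f k (γ t) := by
    intro γ hγ p q hne
    have hne' : ∀ t ∈ uIcc p q, k - γ t ≠ 0 := fun t ht h => hne t ht (sub_eq_zero.1 h).symm
    rw [← intervalIntegral.integral_mul_const, ← intervalIntegral.integral_sub]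
    · apply intervalIntegral.integral_congr
      intro t ht
      have a1 := hne' t ht
      have a2 : γ t - k ≠ 0 := sub_ne_zero.2 (hne t ht)
      simp only
      rw [dslope_of_ne _ (hne t ht), slope_def_field]
      rw [show γ t - k = -(k - γ t) by ring]
      field_simp
      ring
    · apply ContinuousOn.intervalIntegrable
      exact ContinuousOn.mul (ContinuousOn.div continuousOn_const (by fun_prop) hne') continuousOn_const
    · apply ContinuousOn.intervalIntegrable
      intro t ht
      apply ContinuousAt.continuousWithinAt
      exact ContinuousAt.comp ((continuousAt_dslope_of_ne (hne t ht)).2 (hfd _).continuousAt) hγ.continuousAt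
  have k1 := key (fun t => t) (by fun_prop) (-s) s (by
    intro t _ h; have := congrArg Complex.im h; simp at this; linarith)
  have k2 := key (fun t => t + s * I) (by fun_prop) (-s) s (by
    intro t _ h; have := congrArg Complex.im h; simp at this; linarith)
  have k3 := key (fun t => s + t * I) (by fun_prop) 0 s (by
    intro t _ h; have := congrArg Complex.re h; simp at this; linarith)
  have k4 := key (fun t => -s + t * I) (by fun_prop) 0 s (by
    intro t _ h; have := congrArg Complex.re h; simp at this; linarith)
  unfold sqBd at hz ⊢
  rw [k1, k2, k3, k4]
  linear_combination -hz

lemma sq_zero (k : ℂ) (hk : k.im < 0) (s : ℝ) (hs : 0 < s) (x : ℝ) :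
    sqBd (fun z => exp (2 * I * z * x) / (k - z)) s = 0 := by
  have hd : ∀ z : ℂ, 0 ≤ z.im → DifferentiableAt ℂ (fun z => exp (2 * I * z * x) / (k - z)) z := by
    intro z hz
    refine DifferentiableAt.div (by fun_prop) (by fun_prop) ?_
    intro h
    have := congrArg Complex.im h
    simp at this; linarith
  exact sqBd_eq_zero _ s hs ∅ countable_empty (fun z hz => (hd z hz).continuousAt)
    (fun z hz _ => hd z hz)

lemma pt_bound (k z : ℂ) (s x : ℝ) (hs : 0 < s) (hks : 2 * ‖k‖ ≤ s) (hz : s ≤ ‖z‖) :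
    ‖exp (2 * I * z * x) / (k - z)‖ ≤ 2 / s * Real.exp (-(2 * x * z.im)) := by
  have h1 : s / 2 ≤ ‖k - z‖ := by
    have := norm_sub_norm_le z k
    rw [norm_sub_rev] at this
    linarith
  rw [norm_div, Complex.norm_exp]
  have : (2 * I * z * x).re = -(2 * x * z.im) := by simp; ring
  rw [this, div_le_iff₀ (by linarith)]
  have e := Real.exp_pos (-(2 * x * z.im))
  calc Real.exp (-(2 * x * z.im)) = 2 / s * Real.exp (-(2 * x * z.im)) * (s / 2) := by
        field_simp
    _ ≤ _ := by gcongr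

lemma sq_bound (k : ℂ) (s x : ℝ) (hs : 0 < s) (hks : 2 * ‖k‖ ≤ s) :
    ‖(∫ t in (-s)..s, exp (2 * I * t * x) / (k - t))
      - sqBd (fun z => exp (2 * I * z * x) / (k - z)) s‖
      ≤ 4 * Real.exp (-(2 * x * s)) + 2 * ∫ y in (0:ℝ)..s, 2 / s * Real.exp (-(2 * x * y)) := by
  have b1 : ‖∫ t in (-s)..s, exp (2 * I * (t + s * I) * x) / (k - (t + s * I))‖
      ≤ 4 * Real.exp (-(2 * x * s)) := by
    have := intervalIntegral.norm_integral_le_of_norm_le_const (a := -s) (b := s)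
      (f := fun t : ℝ => exp (2 * I * (t + s * I) * x) / (k - (t + s * I)))
      (C := 2 / s * Real.exp (-(2 * x * s))) (by
        intro t _
        have := pt_bound k (t + s * I) s x hs hks (by
          have := Complex.abs_im_le_norm (t + s * I)
          simp at this; exact (le_abs_self s).trans this)
        simpa using this)
    refine this.trans (le_of_eq ?_)
    rw [abs_of_pos (by linarith)]
    field_simp; ring
  have b2 : ∀ σ : ℝ, |σ| = s → ‖∫ y in (0:ℝ)..s, exp (2 * I * (σ + y * I) * x) / (k - (σ + y * I))‖
      ≤ ∫ y in (0:ℝ)..s, 2 / s * Real.exp (-(2 * x * y)) := by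
    intro σ hσ
    apply intervalIntegral.norm_integral_le_of_norm_le hs.le
    · refine ae_of_all _ ?_
      intro t _
      have := pt_bound k (σ + t * I) s x hs hks (by
          have := Complex.abs_re_le_norm (σ + t * I)
          simp at this; rw [← hσ]; exact this)
      simpa using this
    · apply Continuous.intervalIntegrable
      fun_prop
  have b3 := b2 s (abs_of_pos hs)
  have b4 := b2 (-s) (by rw [abs_neg, abs_of_pos hs])
  unfold sqBd
  push_cast at b4
  set A := ∫ t in (-s)..s, exp (2 * I * t * x) / (k - t)
  set B := ∫ t in (-s)..s, exp (2 * I * (t + s * I) * x) / (k - (t + s * I))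
  set C := ∫ y in (0:ℝ)..s, exp (2 * I * (s + y * I) * x) / (k - (s + y * I))
  set D := ∫ y in (0:ℝ)..s, exp (2 * I * (-s + y * I) * x) / (k - (-s + y * I))
  have : A - (A - B + I * C - I * D) = B - I * C + I * D := by ring
  rw [this]
  have n1 := norm_add_le (B - I * C) (I * D)
  have n2 := norm_sub_le B (I * C)
  simp only [norm_mul, norm_I, one_mul] at n1 n2
  linarith

lemma bd_le (s x : ℝ) (hs : 0 < s) (hx : 0 < x) :
    4 * Real.exp (-(2 * x * s)) + 2 * ∫ y in (0:ℝ)..s, 2 / s * Real.exp (-(2 * x * y)) ≤ 8 := by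
  have h1 : Real.exp (-(2 * x * s)) ≤ 1 := Real.exp_le_one_iff.2 (by have := mul_pos hx hs; linarith)
  have h2 : ∫ y in (0:ℝ)..s, 2 / s * Real.exp (-(2 * x * y)) ≤ ∫ y in (0:ℝ)..s, 2 / s := by
    apply intervalIntegral.integral_mono_on hs.le
    · apply Continuous.intervalIntegrable; fun_prop
    · simp
    · intro y hy
      have : Real.exp (-(2 * x * y)) ≤ 1 := Real.exp_le_one_iff.2 (by have := mul_nonneg hx.le hy.1; linarith)
      have h3 : 0 < 2 / s := by positivity
      nlinarith
  have h3 : ∫ y in (0:ℝ)..s, 2 / s = 2 := by simp; field_simp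
  linarith

lemma bd_tendsto (x : ℝ) (hx : 0 < x) :
    Tendsto (fun s : ℝ => 4 * Real.exp (-(2 * x * s))
      + 2 * ∫ y in (0:ℝ)..s, 2 / s * Real.exp (-(2 * x * y))) atTop (nhds 0) := by
  have hI : ∀ s : ℝ, ∫ y in (0:ℝ)..s, 2 / s * Real.exp (-(2 * x * y))
      = s⁻¹ * ((1 - Real.exp (-(2 * x * s))) / x) := by
    intro s
    rw [intervalIntegral.integral_const_mul]
    have : ∫ y in (0:ℝ)..s, Real.exp (-(2 * x * y)) =
        (-1 / (2 * x)) * Real.exp (-(2 * x * s)) - (-1 / (2 * x)) * Real.exp (-(2 * x * 0)) := by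
      apply intervalIntegral.integral_eq_sub_of_hasDerivAt
        (f := fun y => (-1 / (2 * x)) * Real.exp (-(2 * x * y)))
      · intro y _
        have := ((((hasDerivAt_id y).const_mul (2 * x)).neg).exp).const_mul (-1 / (2 * x))
        refine this.congr_deriv ?_
        simp
        field_simp
      · apply Continuous.intervalIntegrable; fun_prop
    rw [this]
    simp
    field_simp
    ring
  simp only [hI]
  have hE : Tendsto (fun s : ℝ => Real.exp (-(2 * x * s))) atTop (nhds 0) := by
    apply Real.tendsto_exp_neg_atTop_nhds_zero.comp
    exact tendsto_id.const_mul_atTop (by positivity)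
  have := (hE.const_mul 4).add ((tendsto_inv_atTop_zero.mul ((hE.const_sub 1).div_const x)).const_mul 2)
  simpa using this

lemma main_lim (g : ℝ → ℂ) (hg : IntegrableOn g (Set.Ioi 0))
    (k : ℂ) (hk : k.im ≠ 0) (L : ℝ → ℂ) (M : ℝ) (hM : ∀ x, 0 < x → ‖L x‖ ≤ M)
    (hL : ∀ x s : ℝ, 0 < x → ‖k‖ < s → sqBd (fun z => exp (2 * I * z * x) / (k - z)) s = L x) :
    Tendsto (fun s : ℝ => ∫ t in (-s)..s,
        (∫ x in Set.Ioi (0:ℝ), Complex.exp (2 * Complex.I * t * x) * g x) / (k - t))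
      atTop (nhds (∫ x in Set.Ioi (0:ℝ), L x * g x)) := by
  have hkt : ∀ t : ℝ, k - t ≠ 0 := by
    intro t h
    have := congrArg Complex.im h
    simp at this; exact hk this
  have hlow : ∀ t : ℝ, |k.im| ≤ ‖k - t‖ := by
    intro t
    have := Complex.abs_im_le_norm (k - t)
    simpa using this
  have hint : ∀ s : ℝ, Integrable (Function.uncurry fun (t x : ℝ) =>
      exp (2 * I * t * x) / (k - t) * g x)
      ((volume.restrict (Ioc (-s) s)).prod (volume.restrict (Ioi 0))) := by
    intro s
    have h1 : Integrable (fun p : ℝ × ℝ => g p.2)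
      ((volume.restrict (Ioc (-s) s)).prod (volume.restrict (Ioi 0))) := hg.comp_snd _
    refine h1.bdd_mul (c := |k.im|⁻¹) (f := fun p : ℝ × ℝ => exp (2 * I * p.1 * p.2) / (k - p.1)) ?_ ?_
    · apply Continuous.aestronglyMeasurable
      exact Continuous.div (by fun_prop) (by fun_prop) (fun p => hkt p.1)
    · refine ae_of_all _ fun p => ?_
      rw [norm_div, Complex.norm_exp]
      have : (2 * I * p.1 * p.2).re = 0 := by simp
      rw [this, Real.exp_zero, one_div]
      exact inv_anti₀ (abs_pos.2 hk) (hlow _)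
  have hev : (fun s : ℝ => ∫ x in Set.Ioi (0:ℝ), (∫ t in (-s)..s, exp (2 * I * t * x) / (k - t)) * g x)
      =ᶠ[atTop] (fun s : ℝ => ∫ t in (-s)..s,
        (∫ x in Set.Ioi (0:ℝ), Complex.exp (2 * Complex.I * t * x) * g x) / (k - t)) := by
    filter_upwards [eventually_ge_atTop 0] with s hs
    simp only [intervalIntegral.integral_of_le (show -s ≤ s by linarith)]
    simp only [← integral_mul_const, ← integral_div]
    rw [← integral_integral_swap (hint s)]
    congr 1; ext t; congr 1; ext x; ring
  refine Tendsto.congr' hev ?_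
  have hbig : ∀ᶠ s : ℝ in atTop, 0 < s ∧ 2 * ‖k‖ ≤ s ∧ ‖k‖ < s := by
    filter_upwards [eventually_gt_atTop 0, eventually_ge_atTop (2 * ‖k‖), eventually_gt_atTop ‖k‖]
      with s a b c using ⟨a, b, c⟩
  apply tendsto_integral_filter_of_dominated_convergence (fun x => (8 + M) * ‖g x‖)
  · filter_upwards [eventually_ge_atTop 0] with s hs
    have := (hint s).integral_prod_right.aestronglyMeasurable
    simp only [intervalIntegral.integral_of_le (show -s ≤ s by linarith), ← integral_mul_const]
    exact this
  · filter_upwards [hbig] with s hs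
    filter_upwards [ae_restrict_mem measurableSet_Ioi] with x hx
    rw [norm_mul]
    gcongr
    have h1 := (sq_bound k s x hs.1 hs.2.1).trans (bd_le s x hs.1 hx)
    rw [hL x s hx hs.2.2] at h1
    have h2 := norm_le_norm_sub_add (∫ t in (-s)..s, exp (2 * I * t * x) / (k - t)) (L x)
    have := hM x hx
    linarith
  · exact hg.norm.const_mul _
  · filter_upwards [ae_restrict_mem measurableSet_Ioi] with x hx
    apply Tendsto.mul_const
    rw [tendsto_iff_norm_sub_tendsto_zero]
    refine squeeze_zero' (Eventually.of_forall fun _ => norm_nonneg _) ?_ (bd_tendsto x hx)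
    filter_upwards [hbig] with s hs
    have h1 := sq_bound k s x hs.1 hs.2.1
    rwa [hL x s hx hs.2.2] at h1

/-- For `g ∈ L¹((0,∞);ℂ)` with `ĝ(t) = ∫_0^∞ e^{2itx} g(x) dx`, and `Im k > 0`,
`p.v.∫ ĝ(t)/(k−t) dt = −2πi·∫_0^∞ e^{2ikx} g(x) dx` and `p.v.∫ ĝ(−t)/(k−t) dt = 0`. -/
theorem cauchy_transform_fourier (g : ℝ → ℂ) (hg : IntegrableOn g (Set.Ioi 0))
    (k : ℂ) (hk : 0 < k.im) :
    Tendsto (fun s : ℝ => ∫ t in (-s)..s,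
        (∫ x in Set.Ioi (0:ℝ), Complex.exp (2 * Complex.I * t * x) * g x) / (k - t))
      atTop
      (nhds (-2 * Real.pi * Complex.I * ∫ x in Set.Ioi (0:ℝ),
        Complex.exp (2 * Complex.I * k * x) * g x)) ∧
    Tendsto (fun s : ℝ => ∫ t in (-s)..s,
        (∫ x in Set.Ioi (0:ℝ), Complex.exp (2 * Complex.I * (-t : ℝ) * x) * g x) / (k - t))
      atTop (nhds 0) := by
  constructor
  · have h := main_lim g hg k hk.ne' (fun x => -(2 * Real.pi * I) * exp (2 * I * k * x))
      (2 * Real.pi) (by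
        intro x hx
        rw [norm_mul, Complex.norm_exp]
        have : (2 * I * k * x).re = -(2 * (k.im * x)) := by simp; ring
        rw [this]
        have h1 : Real.exp (-(2 * (k.im * x))) ≤ 1 :=
          Real.exp_le_one_iff.2 (by have := mul_pos hk hx; linarith)
        have h2 : ‖-(2 * Real.pi * I)‖ = 2 * Real.pi := by
          simp [abs_of_pos Real.pi_pos]
        rw [h2]
        have := Real.pi_pos
        nlinarith) (fun x s _ hs => sq_res k hk s hs x)
    convert h using 2
    rw [← integral_const_mul]
    congr 1; ext x; ring
  · have h := (main_lim g hg (-k) (by simpa using hk.ne') (fun x => 0) 0 (by simp)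
      (fun x s _ hs => sq_zero (-k) (by simpa using hk) s ((norm_nonneg _).trans_lt hs) x)).neg
    simp only [zero_mul, integral_zero, neg_zero] at h
    refine h.congr ?_
    intro s
    rw [← intervalIntegral.integral_neg]
    have := intervalIntegral.integral_comp_neg (a := -s) (b := s) (fun t : ℝ =>
      -((∫ x in Set.Ioi (0:ℝ), Complex.exp (2 * Complex.I * t * x) * g x) / (-k - t)))
    rw [neg_neg] at this
    rw [← this]
    congr 1; ext t
    rw [← div_neg]
    congr 1
    push_cast; ring
end
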